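/- Let G be a non-elementary hyperbolic group and d, d' ∈ D(G) with critical exponents h(d) = h(d') = 1. Then Dil(d,d') ≥ 1. -/

import Mathlib

open Filter Set MeasureTheory Topology

noncomputable section

variable {X : Type*}

/-- The Gromov product `(x|y)_w` with respect to `d`. -/
def gp (d : X → X → ℝ) (w x y : X) : ℝ := (d x w + d y w - d x y) / 2

/-- `d` is a pseudometric. -/
def IsPseudometric (d : X → X → ℝ) : Prop :=
  (∀ x, d x x = 0) ∧ (∀ x y, d x y = d y x) ∧ (∀ x y z, d x z ≤ d x y + d y z)

/-- `d` is `δ`-hyperbolic: the four-point Gromov product condition. -/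
def GromovHyperbolic (d : X → X → ℝ) (δ : ℝ) : Prop :=
  ∀ x y z w, min (gp d w x y) (gp d w y z) - δ ≤ gp d w x z

/-- `d` is `α`-rough geodesic: any two points are joined by an `α`-rough geodesic. -/
def RoughGeodesic (d : X → X → ℝ) (α : ℝ) : Prop :=
  ∀ x y : X, ∃ (n : ℕ) (γ : ℕ → X), γ 0 = x ∧ γ n = y ∧
    ∀ i j : ℕ, i ≤ n → j ≤ n →
      |(i : ℝ) - (j : ℝ)| - α ≤ d (γ i) (γ j) ∧ d (γ i) (γ j) ≤ |(i : ℝ) - (j : ℝ)| + α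

variable {G : Type*} [Group G]

/-- Left invariance of a pseudometric on a group. -/
def LeftInvariant (d : G → G → ℝ) : Prop := ∀ g x y : G, d (g * x) (g * y) = d x y

/-- Word norm with respect to a subset `S`. -/
def wordNorm (S : Set G) (w : G) : ℕ :=
  sInf {k : ℕ | ∃ f : Fin k → G, (∀ i, f i ∈ S) ∧ (List.ofFn f).prod = w}

/-- Word metric with respect to a subset `S`. -/
def wordDist (S : Set G) (x y : G) : ℝ := (wordNorm S (x⁻¹ * y) : ℝ)

/-- `S` is a symmetric generating set. -/
def GenSymm (S : Set G) : Prop := (∀ s ∈ S, s⁻¹ ∈ S) ∧ Subgroup.closure S = ⊤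

/-- `d'` is quasi-isometric to `d` (via the identity map of `G`). -/
def QIsometric (d d' : G → G → ℝ) : Prop :=
  ∃ l1 l2 e : ℝ, 0 < l1 ∧ 0 < l2 ∧ 0 ≤ e ∧
    ∀ x y : G, d x y / l1 - e ≤ d' x y ∧ d' x y ≤ l2 * d x y + e

/-- Membership in `D(G)`: a left-invariant hyperbolic pseudometric on `G`
quasi-isometric to a word metric w.r.t. a finite symmetric generating set. -/
def InD (d : G → G → ℝ) : Prop :=
  IsPseudometric d ∧ LeftInvariant d ∧ (∃ δ ≥ (0 : ℝ), GromovHyperbolic d δ) ∧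
    ∃ S : Finset G, GenSymm (S : Set G) ∧ QIsometric (wordDist (S : Set G)) d

/-- `G` is a hyperbolic group: some word metric is Gromov hyperbolic. -/
def IsHyperbolicGroup (G : Type*) [Group G] : Prop :=
  ∃ S : Finset G, GenSymm (S : Set G) ∧ ∃ δ ≥ (0 : ℝ), GromovHyperbolic (wordDist (S : Set G)) δ

/-- `G` is non-elementary: it is not virtually abelian. -/
def NonElementary (G : Type*) [Group G] : Prop :=
  ¬ ∃ H : Subgroup G, H.FiniteIndex ∧ ∀ a ∈ H, ∀ b ∈ H, a * b = b * a

/-- Translation length `ℓ_d(x) = lim_n d(x^n,1)/n`; by Fekete's subadditivity lemma the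
limit exists and equals the infimum of `d(x^n,1)/n` over `n ≥ 1`. -/
def tlen (d : G → G → ℝ) (x : G) : ℝ :=
  sInf {r : ℝ | ∃ n : ℕ, r = d (x ^ (n + 1)) 1 / (n + 1)}

/-- Dilation `Dil(d,d') = sup_x ℓ_d(x)/ℓ_{d'}(x)` over infinite-order elements. -/
def Dil (d d' : G → G → ℝ) : ℝ :=
  sSup {r : ℝ | ∃ x : G, ¬ IsOfFinOrder x ∧ r = tlen d x / tlen d' x}

/-- Critical exponent `h(d) = lim_n log|B_d(n)|/n` (the limit exists, so it equals
the limsup used here). -/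
def hCrit (d : G → G → ℝ) : ℝ :=
  Filter.limsup (fun n : ℕ => Real.log (Set.ncard {x : G | d x 1 ≤ (n : ℝ)}) / (n : ℝ)) atTop

/-- `Λ(d1,d2)`: the infimum of `λ1·λ2` over quasi-isometry constants between `d1,d2`. -/
def Lam (d1 d2 : G → G → ℝ) : ℝ :=
  sInf {l : ℝ | ∃ l1 l2 A : ℝ, 0 < l1 ∧ 0 < l2 ∧ 0 ≤ A ∧ l = l1 * l2 ∧
    ∀ x y : G, d2 x y / l1 - A ≤ d1 x y ∧ d1 x y ≤ l2 * d2 x y + A}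

/-! ### Word norms -/

theorem wn_le {S : Set G} (l : List G) (hl : ∀ s ∈ l, s ∈ S) :
    wordNorm S l.prod ≤ l.length := by
  apply Nat.sInf_le
  refine ⟨fun i => l.get i, fun i => hl _ (List.get_mem _ _), ?_⟩
  rw [List.ofFn_get]

theorem wn_exists {S : Set G} (hS : GenSymm S) (x : G) :
    ∃ l : List G, (∀ s ∈ l, s ∈ S) ∧ l.length = wordNorm S x ∧ l.prod = x := by
  have hne : {k : ℕ | ∃ f : Fin k → G, (∀ i, f i ∈ S) ∧ (List.ofFn f).prod = x}.Nonempty := by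
    have hx : x ∈ Subgroup.closure S := by rw [hS.2]; trivial
    rw [← Subgroup.mem_toSubmonoid, Subgroup.closure_toSubmonoid] at hx
    obtain ⟨l, hl, hp⟩ := Submonoid.exists_list_of_mem_closure hx
    refine ⟨l.length, fun i => l.get i, fun i => ?_, ?_⟩
    · rcases hl _ (List.get_mem l i) with h | h
      · exact h
      · have := hS.1 _ (Set.mem_inv.1 h)
        rwa [inv_inv] at this
    · rw [List.ofFn_get]; exact hp
  obtain ⟨f, hf, hp⟩ := Nat.sInf_mem hne
  refine ⟨List.ofFn f, ?_, ?_, hp⟩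
  · intro s hs
    rw [List.mem_ofFn] at hs
    obtain ⟨i, rfl⟩ := hs
    exact hf i
  · rw [List.length_ofFn]; rfl

theorem wn_mul_le {S : Set G} (hS : GenSymm S) (x y : G) :
    wordNorm S (x * y) ≤ wordNorm S x + wordNorm S y := by
  obtain ⟨l, hl, hn, hp⟩ := wn_exists hS x
  obtain ⟨l', hl', hn', hp'⟩ := wn_exists hS y
  have := wn_le (S := S) (l ++ l') (by
    intro s hs
    rcases List.mem_append.1 hs with h | h
    · exact hl s h
    · exact hl' s h)
  rw [List.prod_append, List.length_append, hp, hp', hn, hn'] at this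
  exact this

theorem wn_split {S : Set G} (hS : GenSymm S) (x : G) (a b : ℕ) (h : wordNorm S x = a + b) :
    ∃ g k : G, x = g * k ∧ wordNorm S g = a ∧ wordNorm S k = b := by
  obtain ⟨l, hl, hn, hp⟩ := wn_exists hS x
  have h1 := wn_le (S := S) (l.take a) (fun s hs => hl s (List.mem_of_mem_take hs))
  have h2 := wn_le (S := S) (l.drop a) (fun s hs => hl s (List.mem_of_mem_drop hs))
  have h3 : (l.take a).prod * (l.drop a).prod = x := by rw [List.prod_take_mul_prod_drop, hp]
  have h4 := wn_mul_le hS (l.take a).prod (l.drop a).prod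
  rw [h3] at h4
  rw [List.length_take] at h1
  rw [List.length_drop] at h2
  exact ⟨_, _, h3.symm, by omega, by omega⟩

open Classical Pointwise in
theorem mem_pow_iff {S : Finset G} (hS : GenSymm (S : Set G)) (n : ℕ) (x : G) :
    x ∈ (insert 1 S : Finset G) ^ n ↔ wordNorm (S : Set G) x ≤ n := by
  constructor
  · intro h
    induction n generalizing x with
    | zero =>
      rw [pow_zero, Finset.mem_one] at h
      subst h
      simpa using wn_le (S := (S : Set G)) [] (by simp)
    | succ n ih =>
      rw [pow_succ] at h
      obtain ⟨y, hy, z, hz, rfl⟩ := Finset.mem_mul.1 h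
      have h1 := ih y hy
      have h2 := wn_mul_le hS y z
      have h3 : wordNorm (S : Set G) z ≤ 1 := by
        rcases Finset.mem_insert.1 hz with rfl | hz
        · exact (wn_le (S := (S : Set G)) [] (by simp)).trans (by simp)
        · simpa using wn_le (S := (S : Set G)) [z] (by simpa using hz)
      omega
  · intro h
    obtain ⟨l, hl, hn, hp⟩ := wn_exists hS x
    have key : ∀ l : List G, (∀ s ∈ l, s ∈ (S : Set G)) →
        l.prod ∈ (insert 1 S : Finset G) ^ l.length := by
      intro l
      induction l with
      | nil => intro _; simp
      | cons a l ih =>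
        intro hl
        rw [List.prod_cons, List.length_cons, pow_succ']
        refine Finset.mul_mem_mul ?_ (ih fun s hs => hl s (List.mem_cons_of_mem _ hs))
        exact Finset.mem_insert_of_mem (by simpa using hl a (by simp))
    have h1 := key l hl
    rw [hp, hn] at h1
    exact Finset.pow_subset_pow_right (Finset.mem_insert_self _ _) h h1

/-! ### Left invariant pseudometrics -/

theorem pm_nonneg {d : G → G → ℝ} (hp : IsPseudometric d) (x y : G) : 0 ≤ d x y := by
  have h1 := hp.2.2 x y x
  rw [hp.1, hp.2.1 y x] at h1
  linarith

theorem four_pt {d : X → X → ℝ} {δ : ℝ} (hp : IsPseudometric d) (hh : GromovHyperbolic d δ)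
    (x y z w : X) :
    d x z + d y w ≤ d x y + d z w + 2 * δ ∨ d x z + d y w ≤ d y z + d x w + 2 * δ := by
  have := hh x y z w
  unfold gp at this
  rcases min_cases ((d x w + d y w - d x y) / 2) ((d y w + d z w - d y z) / 2) with h | h
  · left; rw [h.1] at this; linarith
  · right; rw [h.1] at this; linarith

theorem d_one_mul {d : G → G → ℝ} (hp : IsPseudometric d) (hl : LeftInvariant d) (x y : G) :
    d (x * y) 1 ≤ d x 1 + d y 1 := by
  have h1 := hp.2.2 (x * y) x 1
  have h2 := hl x y 1
  rw [mul_one] at h2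
  linarith

theorem d_eq_inv_mul {d : G → G → ℝ} (hl : LeftInvariant d) (x y : G) :
    d x y = d (y⁻¹ * x) 1 := by
  have := hl y⁻¹ x y
  rw [inv_mul_cancel] at this
  exact this.symm

theorem d_inv {d : G → G → ℝ} (hp : IsPseudometric d) (hl : LeftInvariant d) (x : G) :
    d x⁻¹ 1 = d x 1 := by
  have := hl x x⁻¹ 1
  rw [mul_one, mul_inv_cancel] at this
  rw [← this, hp.2.1]

theorem d_pow {d : G → G → ℝ} (hp : IsPseudometric d) (hl : LeftInvariant d) (x : G) (n : ℕ) :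
    d (x ^ n) 1 ≤ n * d x 1 := by
  induction n with
  | zero => simp [hp.1]
  | succ n ih =>
    rw [pow_succ]
    have := d_one_mul hp hl (x ^ n) x
    push_cast
    linarith

theorem d_le_word {d : G → G → ℝ} (hp : IsPseudometric d) (hl : LeftInvariant d)
    {S : Finset G} (hS : GenSymm (S : Set G)) :
    ∃ M : ℝ, 0 ≤ M ∧ ∀ x, d x 1 ≤ M * wordNorm (S : Set G) x := by
  refine ⟨∑ s ∈ S, d s 1, Finset.sum_nonneg fun s _ => pm_nonneg hp _ _, fun x => ?_⟩
  obtain ⟨l, hl', hn, rfl⟩ := wn_exists hS x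
  rw [← hn]
  clear hn
  induction l with
  | nil => simp [hp.1]
  | cons a l ih =>
    rw [List.prod_cons, List.length_cons]
    have h1 := d_one_mul hp hl a l.prod
    have h2 := ih fun s hs => hl' s (List.mem_cons_of_mem _ hs)
    have h3 : d a 1 ≤ ∑ s ∈ S, d s 1 :=
      Finset.single_le_sum (f := fun s => d s 1) (fun s _ => pm_nonneg hp _ _)
        (by simpa using hl' a (by simp))
    push_cast
    linarith

theorem compare {d d' : G → G → ℝ} (hd : InD d) (hd' : InD d') :
    ∃ A B : ℝ, 0 ≤ A ∧ 0 ≤ B ∧ ∀ x, d x 1 ≤ A * d' x 1 + B := by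
  obtain ⟨hp, hl, -, -⟩ := hd
  obtain ⟨hp', hl', -, S, hS, l1, l2, e, h1, h2, he, hq⟩ := hd'
  obtain ⟨M, hM, hM'⟩ := d_le_word hp hl hS
  refine ⟨M * l1, M * (l1 * e), by positivity, by positivity, fun x => ?_⟩
  have h3 := (hq 1 x).1
  have h4 := hM' x
  unfold wordDist at h3
  rw [inv_one, one_mul, hp'.2.1] at h3
  have h5 : (wordNorm (S : Set G) x : ℝ) ≤ l1 * (d' x 1 + e) := by
    have : (wordNorm (S : Set G) x : ℝ) / l1 ≤ d' x 1 + e := by linarith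
    rw [div_le_iff₀ h1] at this
    linarith
  nlinarith [mul_le_mul_of_nonneg_left h5 hM]

/-! ### Translation lengths -/

theorem tlen_bdd {d : G → G → ℝ} (hp : IsPseudometric d) (x : G) :
    BddBelow {r : ℝ | ∃ n : ℕ, r = d (x ^ (n + 1)) 1 / (n + 1)} := by
  refine ⟨0, ?_⟩
  rintro r ⟨n, rfl⟩
  exact div_nonneg (pm_nonneg hp _ _) (by positivity)

theorem tlen_le {d : G → G → ℝ} (hp : IsPseudometric d) (x : G) (n : ℕ) :
    tlen d x ≤ d (x ^ (n + 1)) 1 / (n + 1) :=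
  csInf_le (tlen_bdd hp x) ⟨n, rfl⟩

theorem le_tlen {d : G → G → ℝ} (x : G) (t : ℝ)
    (h : ∀ n : ℕ, t ≤ d (x ^ (n + 1)) 1 / (n + 1)) : t ≤ tlen d x := by
  refine le_csInf ⟨_, 0, rfl⟩ ?_
  rintro r ⟨n, rfl⟩
  exact h n

theorem tlen_nonneg {d : G → G → ℝ} (hp : IsPseudometric d) (x : G) : 0 ≤ tlen d x :=
  le_tlen x 0 fun _ => div_nonneg (pm_nonneg hp _ _) (by positivity)

theorem tlen_le_norm {d : G → G → ℝ} (hp : IsPseudometric d) (x : G) : tlen d x ≤ d x 1 := by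
  simpa using tlen_le hp x 0

theorem tlen_fin {d : G → G → ℝ} (hp : IsPseudometric d) (x : G) (hx : IsOfFinOrder x) :
    tlen d x = 0 := by
  refine le_antisymm ?_ (tlen_nonneg hp x)
  obtain ⟨n, hn, h⟩ := isOfFinOrder_iff_pow_eq_one.1 hx
  have := tlen_le hp x (n - 1)
  rw [Nat.sub_add_cancel hn, h, hp.1, zero_div] at this
  exact this

theorem tlen_compare {d d' : G → G → ℝ} (hp : IsPseudometric d)
    (hp' : IsPseudometric d') (hl' : LeftInvariant d') {A B : ℝ} (hA : 0 ≤ A) (hB : 0 ≤ B)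
    (h : ∀ x, d x 1 ≤ A * d' x 1 + B) (x : G) : tlen d x ≤ A * tlen d' x := by
  have key : ∀ n : ℕ, tlen d x ≤ A * (d' (x ^ (n + 1)) 1 / (n + 1)) := by
    intro n
    apply le_of_forall_pos_le_add
    intro ε hε
    obtain ⟨k, hk⟩ := exists_nat_gt (B / ε)
    have h1 := tlen_le hp x ((n + 1) * (k + 1) - 1)
    rw [Nat.sub_add_cancel (Nat.mul_pos (Nat.succ_pos _) (Nat.succ_pos _))] at h1
    have e1 : (((n + 1) * (k + 1) - 1 : ℕ) : ℝ) + 1 = (n + 1) * (k + 1) := by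
      rw [Nat.cast_sub (Nat.mul_pos (Nat.succ_pos _) (Nat.succ_pos _))]
      push_cast; ring
    rw [e1] at h1
    have h2 := h (x ^ ((n + 1) * (k + 1)))
    have h3 := d_pow hp' hl' (x ^ (n + 1)) (k + 1)
    rw [← pow_mul] at h3
    have hn0 : (0 : ℝ) ≤ n := Nat.cast_nonneg n
    have hk0 : (0 : ℝ) ≤ k := Nat.cast_nonneg k
    have h4 : B ≤ ε * k := by
      rw [div_lt_iff₀ hε] at hk; linarith
    refine h1.trans ?_
    rw [div_le_iff₀ (by positivity)]
    have e2 : (A * (d' (x ^ (n + 1)) 1 / (n + 1)) + ε) * (((n : ℝ) + 1) * (k + 1)) =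
        A * ((k + 1) * d' (x ^ (n + 1)) 1) + ε * (((n : ℝ) + 1) * (k + 1)) := by
      field_simp
    rw [e2]
    push_cast at h3
    have h5 := mul_le_mul_of_nonneg_left h3 hA
    have h6 : ε * k ≤ ε * (((n : ℝ) + 1) * (k + 1)) := by
      apply mul_le_mul_of_nonneg_left _ hε.le
      nlinarith [mul_nonneg hn0 hk0]
    linarith
  rcases hA.eq_or_lt with h0 | h0
  · have := key 0
    rw [← h0] at this ⊢
    simpa using this
  · rw [mul_comm, ← div_le_iff₀ h0]
    apply le_tlen
    intro n
    rw [div_le_iff₀ h0, mul_comm]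
    exact key n

theorem tlen_lower {d : G → G → ℝ} (hp : IsPseudometric d) (hl : LeftInvariant d)
    {δ : ℝ} (hδ : 0 ≤ δ) (hh : GromovHyperbolic d δ) (g : G) :
    d (g ^ 2) 1 - d g 1 - 2 * δ ≤ tlen d g := by
  set t := d (g ^ 2) 1 - d g 1 - 2 * δ with ht
  rcases le_or_gt t 0 with h0 | h0
  · exact h0.trans (tlen_nonneg hp g)
  have step : ∀ n : ℕ, d (g ^ n) 1 + t ≤ d (g ^ (n + 1)) 1 := by
    intro n
    induction n with
    | zero =>
      have := d_pow hp hl g 2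
      simp only [pow_zero, hp.1, zero_add, pow_one]
      push_cast at this
      linarith
    | succ n ih =>
      have h4 := four_pt hp hh 1 g (g ^ 2) (g ^ (n + 2))
      have a1 : d 1 (g ^ 2) = d (g ^ 2) 1 := hp.2.1 _ _
      have a2 : d g (g ^ (n + 2)) = d (g ^ (n + 1)) 1 := by
        rw [hp.2.1, d_eq_inv_mul hl]; congr 1; group
      have a3 : d 1 g = d g 1 := hp.2.1 _ _
      have a4 : d (g ^ 2) (g ^ (n + 2)) = d (g ^ n) 1 := by
        rw [hp.2.1, d_eq_inv_mul hl]; congr 1; group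
      have a5 : d g (g ^ 2) = d g 1 := by
        rw [hp.2.1, d_eq_inv_mul hl]; congr 1; group
      have a6 : d 1 (g ^ (n + 2)) = d (g ^ (n + 2)) 1 := hp.2.1 _ _
      rw [a1, a2, a3, a4, a5, a6] at h4
      show _ ≤ d (g ^ (n + 2)) 1
      rcases h4 with h4 | h4 <;> linarith
  have all : ∀ n : ℕ, n * t ≤ d (g ^ n) 1 := by
    intro n
    induction n with
    | zero => simp [hp.1]
    | succ n ih =>
      have := step n
      push_cast
      linarith
  apply le_tlen
  intro n
  rw [le_div_iff₀ (by positivity)]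
  have := all (n + 1)
  push_cast at this
  linarith

/-! ### The pigeonhole argument -/

open Classical in
theorem pigeon {d : G → G → ℝ} (hp : IsPseudometric d) (hl : LeftInvariant d)
    {δ : ℝ} (hδ : 0 ≤ δ) (hh : GromovHyperbolic d δ) (p : G) (r c : ℝ) (hr : 0 ≤ r) (hc : 0 ≤ c)
    (hP : r + c + δ < d p 1) (B E : Finset G) (hB : ∀ f ∈ B, d f 1 ≤ r) (h1B : 1 ∈ B)
    (hE : ∀ f, d f 1 ≤ 2 * c + 6 * δ + 1 → f ∈ E)
    (hcard : (⌊d p 1 + r⌋₊ + 1) * E.card < B.card)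
    (x y : G) (hx : d x p ≤ d x 1 - d p 1 + 2 * c) :
    ∃ f ∈ B, d (f * x) 1 + d y 1 - d (f * x) y ≤ 2 * (d p 1 + r) + 2 * δ := by
  by_contra hcon
  push Not at hcon
  have gpr : ∀ u v w : G, d u 1 + d v 1 - d u v - 2 * δ ≤ d u 1 + d w 1 - d u w ∨
      d v 1 + d w 1 - d v w - 2 * δ ≤ d u 1 + d w 1 - d u w := by
    intro u v w
    rcases four_pt hp hh u v w 1 with h | h
    · left; linarith
    · right; linarith
  have hfp : ∀ f ∈ B, 2 * (d (f * p) 1) - 2 * c - 4 * δ ≤ d (f * p) 1 + d x 1 - d (f * p) x := by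
    intro f hf
    have hfr := hB f hf
    have b1 : d (f * p) 1 ≤ r + d p 1 := by linarith [d_one_mul hp hl f p]
    have b2 : d p 1 ≤ r + d (f * p) 1 := by
      have := d_one_mul hp hl f⁻¹ (f * p)
      rw [inv_mul_cancel_left, d_inv hp hl] at this
      linarith
    have s1 : 2 * (d p 1 + r) ≤ d (f * x) 1 + d x 1 - d (f * x) x := by
      have i1 := hcon f hf
      have i2 := hcon 1 h1B
      rw [one_mul, hp.2.1 x y] at i2
      rcases gpr (f * x) y x with h | h <;> linarith
    have s2 : 2 * d (f * p) 1 - 2 * c - 2 * δ ≤ d (f * p) 1 + d (f * x) 1 - d (f * p) (f * x) := by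
      have a1 : d 1 f = d f 1 := hp.2.1 _ _
      have a2 : d 1 (f * p) = d (f * p) 1 := hp.2.1 _ _
      have a3 : d 1 (f * x) = d (f * x) 1 := hp.2.1 _ _
      have a4 : d (f * p) (f * x) = d x p := by rw [hl, hp.2.1]
      have a5 : d f (f * p) = d p 1 := by
        have := hl f 1 p
        rw [mul_one] at this
        rw [this, hp.2.1]
      have a6 : d f (f * x) = d x 1 := by
        have := hl f 1 x
        rw [mul_one] at this
        rw [this, hp.2.1]
      have h4 := four_pt hp hh 1 f (f * p) (f * x)
      rw [a1, a2, a3, a4, a5, a6] at h4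
      rw [a4]
      rcases h4 with h4 | h4 <;> linarith
    rcases gpr (f * p) (f * x) x with h | h <;> linarith
  obtain ⟨k, -, hk⟩ := Finset.exists_lt_card_fiber_of_mul_lt_card_of_maps_to
    (s := B) (t := Finset.range (⌊d p 1 + r⌋₊ + 1)) (f := fun f => ⌊d (f * p) 1⌋₊) (n := E.card)
    (by
      intro f hf
      rw [Finset.mem_range, Nat.lt_succ_iff]
      apply Nat.floor_le_floor
      linarith [d_one_mul hp hl f p, hB f hf])
    (by rw [Finset.card_range]; exact hcard)
  obtain ⟨f0, hf0⟩ : (B.filter fun f => ⌊d (f * p) 1⌋₊ = k).Nonempty := by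
    rw [← Finset.card_pos]; omega
  refine absurd hk (not_lt.2 ?_)
  apply Finset.card_le_card_of_injOn (fun f => (f0 * p)⁻¹ * (f * p))
  · intro f hf
    rw [Finset.mem_coe, Finset.mem_filter] at hf
    rw [Finset.mem_filter] at hf0
    apply hE
    rw [← d_eq_inv_mul hl]
    have i1 := hfp f hf.1
    have i2 := hfp f0 hf0.1
    have i3 := Nat.floor_le (pm_nonneg hp (f * p) 1)
    have i4 := Nat.lt_floor_add_one (d (f * p) 1)
    have i5 := Nat.floor_le (pm_nonneg hp (f0 * p) 1)
    have i6 := Nat.lt_floor_add_one (d (f0 * p) 1)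
    rw [hf.2] at i3 i4
    rw [hf0.2] at i5 i6
    rw [hp.2.1 (f0 * p) x] at i2
    rcases gpr (f * p) x (f0 * p) with h | h <;> linarith
  · intro a _ b _ hab
    simpa using hab

/-! ### Growth -/

theorem hCrit_not_eventually {d : G → G → ℝ} (h : hCrit d = 1) {a : ℝ} (ha : a < 1) :
    ¬ ∀ᶠ n : ℕ in atTop, Real.log (Set.ncard {x : G | d x 1 ≤ (n : ℝ)}) / (n : ℝ) ≤ a := by
  intro hev
  have hb : BddBelow {a : ℝ | ∀ᶠ n : ℕ in atTop,
      Real.log (Set.ncard {x : G | d x 1 ≤ (n : ℝ)}) / (n : ℝ) ≤ a} := by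
    refine ⟨0, fun b hb => ?_⟩
    obtain ⟨n, hn⟩ := Filter.Eventually.exists (f := atTop) hb
    exact le_trans (div_nonneg (Real.log_natCast_nonneg _) (Nat.cast_nonneg _)) hn
  have h1 : hCrit d ≤ a := by
    unfold hCrit
    rw [Filter.limsup_eq]
    exact csInf_le hb hev
  linarith

theorem hCrit_eventually {d : G → G → ℝ} (h : hCrit d = 1) {a : ℝ} (ha : 1 < a) :
    ∀ᶠ n : ℕ in atTop, Real.log (Set.ncard {x : G | d x 1 ≤ (n : ℝ)}) / (n : ℝ) ≤ a := by
  unfold hCrit at h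
  rw [Filter.limsup_eq] at h
  have hne : {a : ℝ | ∀ᶠ n : ℕ in atTop,
      Real.log (Set.ncard {x : G | d x 1 ≤ (n : ℝ)}) / (n : ℝ) ≤ a}.Nonempty := by
    by_contra hem
    rw [Set.not_nonempty_iff_eq_empty] at hem
    rw [hem, Real.sInf_empty] at h
    norm_num at h
  obtain ⟨b, hb, hba⟩ := exists_lt_of_csInf_lt hne (h.trans_lt ha)
  filter_upwards [hb] with n hn
  exact hn.trans hba.le

theorem eventually_div_le {A B a : ℝ} (h : A < a) :
    ∀ᶠ n : ℕ in atTop, 0 < n ∧ (A * n + B) / (n : ℝ) ≤ a := by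
  obtain ⟨k, hk⟩ := exists_nat_gt (B / (a - A))
  filter_upwards [eventually_ge_atTop (k + 1)] with n hn
  have h0 : 0 < n := by omega
  refine ⟨h0, ?_⟩
  have h1 : (0 : ℝ) < n := by exact_mod_cast h0
  rw [div_le_iff₀ h1]
  rw [div_lt_iff₀ (by linarith)] at hk
  have h2 : (k : ℝ) ≤ n := by exact_mod_cast (by omega : k ≤ n)
  nlinarith

open Classical Pointwise in
theorem dball_sub {d : G → G → ℝ} {S : Finset G} (hS : GenSymm (S : Set G)) {l1 e : ℝ}
    (h1 : 0 < l1) (hW : ∀ x, (wordNorm (S : Set G) x : ℝ) / l1 - e ≤ d x 1) (t : ℝ) (x : G)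
    (hx : d x 1 ≤ t) : x ∈ (insert 1 S : Finset G) ^ ⌊l1 * (t + e)⌋₊ := by
  rw [mem_pow_iff hS]
  apply Nat.le_floor
  have h2 := hW x
  have h3 : (wordNorm (S : Set G) x : ℝ) / l1 ≤ t + e := by linarith
  rw [div_le_iff₀ h1] at h3
  linarith

open Classical Pointwise in
theorem growth_lower {d : G → G → ℝ} (hc : hCrit d = 1) {S : Finset G}
    (hS : GenSymm (S : Set G)) {l1 e : ℝ} (h1 : 0 < l1) (he : 0 ≤ e)
    (hW : ∀ x, (wordNorm (S : Set G) x : ℝ) / l1 - e ≤ d x 1) :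
    ∃ η : ℝ, 0 < η ∧ ∀ n : ℕ, Real.exp (η * n) ≤ (((insert 1 S : Finset G) ^ n).card : ℝ) := by
  refine ⟨1 / (4 * l1), by positivity, fun n => ?_⟩
  by_contra hlt
  push Not at hlt
  set T : Finset G := insert 1 S with hT
  have h1T : (1 : G) ∈ T := Finset.mem_insert_self _ _
  have hcard1 : ∀ j : ℕ, 1 ≤ (T ^ j).card := fun j =>
    Finset.card_pos.2 ⟨1, by simpa using Finset.pow_mem_pow h1T (n := j)⟩
  have hn : 0 < n := by
    rcases Nat.eq_zero_or_pos n with rfl | h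
    · simp at hlt
    · exact h
  set η := 1 / (4 * l1) with hη
  have hη0 : 0 < η := by positivity
  have hηl : η * l1 = 1 / 4 := by rw [hη]; field_simp
  have hlog : Real.log ((T ^ n).card : ℝ) ≤ η * n := by
    rw [Real.log_le_iff_le_exp (by exact_mod_cast hcard1 n)]
    exact hlt.le
  have hj : ∀ j : ℕ, Real.log ((T ^ j).card : ℝ) ≤ η * (j + n) := by
    intro j
    have e1 : T ^ j ⊆ (T ^ n) ^ (j / n + 1) := by
      rw [← pow_mul]
      apply Finset.pow_subset_pow_right h1T
      have := Nat.div_add_mod j n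
      have := Nat.mod_lt j hn
      rw [mul_add]; omega
    have e2 : ((T ^ j).card : ℝ) ≤ ((T ^ n).card : ℝ) ^ (j / n + 1) := by
      exact_mod_cast (Finset.card_le_card e1).trans Finset.card_pow_le
    have e3 := Real.log_le_log (by exact_mod_cast hcard1 j) e2
    rw [Real.log_pow] at e3
    refine e3.trans ?_
    have e4 : ((j / n + 1 : ℕ) : ℝ) * n ≤ j + n := by
      have := Nat.div_mul_le_self j n
      have : (j / n + 1) * n ≤ j + n := by rw [add_mul]; omega
      exact_mod_cast this
    calc ((j / n + 1 : ℕ) : ℝ) * Real.log ((T ^ n).card : ℝ)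
        ≤ ((j / n + 1 : ℕ) : ℝ) * (η * n) := by gcongr
      _ = η * (((j / n + 1 : ℕ) : ℝ) * n) := by ring
      _ ≤ η * (j + n) := by gcongr
  refine hCrit_not_eventually hc (a := 1 / 2) (by norm_num) ?_
  filter_upwards [eventually_div_le (A := 1 / 4) (B := η * (l1 * e + n)) (a := 1 / 2)
    (by norm_num)] with t ht
  refine le_trans ?_ ht.2
  have ht0 : (0 : ℝ) < t := by exact_mod_cast ht.1
  gcongr
  have k1 : {x : G | d x 1 ≤ (t : ℝ)} ⊆ ((T ^ ⌊l1 * (t + e)⌋₊ : Finset G) : Set G) :=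
    fun x hx => dball_sub hS h1 hW t x hx
  have k2 := Set.ncard_le_ncard k1 (Finset.finite_toSet _)
  rw [Set.ncard_coe_finset] at k2
  have k3 : Real.log (Set.ncard {x : G | d x 1 ≤ (t : ℝ)}) ≤
      Real.log ((T ^ ⌊l1 * (t + e)⌋₊).card : ℝ) := by
    rcases Nat.eq_zero_or_pos (Set.ncard {x : G | d x 1 ≤ (t : ℝ)}) with h0 | h0
    · rw [h0]; simpa using Real.log_natCast_nonneg _
    · exact Real.log_le_log (by exact_mod_cast h0) (by exact_mod_cast k2)
  have k4 : (⌊l1 * (t + e)⌋₊ : ℝ) ≤ l1 * (t + e) := Nat.floor_le (by positivity)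
  have k5 := hj ⌊l1 * (t + e)⌋₊
  calc _ ≤ _ := k3
    _ ≤ _ := k5
    _ ≤ η * (l1 * (t + e) + n) := by gcongr
    _ = (η * l1) * t + η * (l1 * e + n) := by ring
    _ = _ := by rw [hηl]

open Classical Pointwise in
theorem exists_wn_eq {S : Finset G} (hS : GenSymm (S : Set G)) {η : ℝ} (hη : 0 < η)
    (h : ∀ n : ℕ, Real.exp (η * n) ≤ (((insert 1 S : Finset G) ^ n).card : ℝ)) (n : ℕ) :
    ∃ x : G, wordNorm (S : Set G) x = n := by
  set T : Finset G := insert 1 S with hT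
  obtain ⟨k, hk⟩ := exists_nat_gt (((T ^ n).card : ℝ) / η)
  rw [div_lt_iff₀ hη] at hk
  have h1 := h k
  have h2 := Real.add_one_le_exp (η * k)
  have h3 : (T ^ n).card < (T ^ k).card := by
    have : ((T ^ n).card : ℝ) < ((T ^ k).card : ℝ) := by linarith
    exact_mod_cast this
  obtain ⟨x, -, hx⟩ := Finset.exists_mem_notMem_of_card_lt_card h3
  rw [mem_pow_iff hS] at hx
  push Not at hx
  obtain ⟨g, k, -, hg, -⟩ := wn_split hS x n (wordNorm (S : Set G) x - n) (by omega)
  exact ⟨g, hg⟩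

theorem doubling {d : G → G → ℝ} (hp : IsPseudometric d) {S : Finset G}
    (hS : GenSymm (S : Set G)) (hall : ∀ n : ℕ, ∃ x : G, wordNorm (S : Set G) x = n)
    {l2 e : ℝ} (he : 0 ≤ e)
    (hW : ∀ x, d x 1 ≤ l2 * (wordNorm (S : Set G) x : ℝ) + e)
    {κ : ℝ} (hκ : 0 < κ) (m0 : ℕ) (hm0 : 1 ≤ m0) :
    ∃ m : ℕ, m0 ≤ m ∧ ∃ g h : G, wordNorm (S : Set G) g = m ∧ wordNorm (S : Set G) h = m ∧
      d g 1 + d h 1 - 2 * (κ * m) < d (g * h) 1 := by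
  by_contra hcon
  push Not at hcon
  have hm : (1 : ℝ) ≤ m0 := by exact_mod_cast hm0
  have key : ∀ k : ℕ, ∀ x : G, wordNorm (S : Set G) x = 2 ^ k * m0 →
      d x 1 ≤ 2 ^ k * m0 * ((l2 + e) - k * κ) := by
    intro k
    induction k with
    | zero =>
      intro x hx
      have := hW x
      rw [hx] at this
      push_cast at this ⊢
      nlinarith
    | succ k ih =>
      intro x hx
      obtain ⟨g, h, rfl, hg, hh⟩ := wn_split hS x (2 ^ k * m0) (2 ^ k * m0) (by rw [hx]; ring)
      have h1 := ih g hg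
      have h2 := ih h hh
      have h3 := hcon (2 ^ k * m0) (Nat.le_mul_of_pos_left _ (by positivity)) g h hg hh
      push_cast at h3 ⊢
      calc _ ≤ _ := h3
        _ ≤ 2 * (2 ^ k * m0 * ((l2 + e) - k * κ)) - 2 * (κ * (2 ^ k * m0)) := by linarith
        _ = _ := by ring
  obtain ⟨k, hk⟩ := exists_nat_gt ((l2 + e) / κ)
  rw [div_lt_iff₀ hκ] at hk
  obtain ⟨x, hx⟩ := hall (2 ^ k * m0)
  have h1 := key k x hx
  have h2 := pm_nonneg hp x 1
  have h3 : (0 : ℝ) < 2 ^ k * m0 := by positivity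
  nlinarith

theorem exp_beats {a : ℝ} (ha : 0 < a) (α β γ : ℝ) :
    ∀ᶠ m : ℕ in atTop, α * m + β < Real.exp (a * m - γ) := by
  obtain ⟨k, hk⟩ := exists_nat_gt (max (4 * |γ| / a) (max 1 (16 * (|α| + |β|) / a ^ 2)))
  filter_upwards [eventually_ge_atTop k] with m hm
  have hm' : (k : ℝ) ≤ m := by exact_mod_cast hm
  have h1 : 4 * |γ| / a < m := (lt_of_le_of_lt (le_max_left _ _) hk).trans_le hm'
  have h2 : 1 < (m : ℝ) :=
    (lt_of_le_of_lt ((le_max_left _ _).trans (le_max_right _ _)) hk).trans_le hm'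
  have h3 : 16 * (|α| + |β|) / a ^ 2 < m :=
    (lt_of_le_of_lt ((le_max_right _ _).trans (le_max_right _ _)) hk).trans_le hm'
  rw [div_lt_iff₀ ha] at h1
  rw [div_lt_iff₀ (by positivity)] at h3
  have h4 : a * m / 2 ≤ a * m - γ := by
    have := le_abs_self γ
    have := abs_nonneg γ
    linarith
  have h5 : (a * m / 2) ^ 2 / 2 ≤ Real.exp (a * m / 2) := by
    have := Real.quadratic_le_exp_of_nonneg (x := a * m / 2) (by positivity)
    have : 0 ≤ a * m / 2 := by positivity
    linarith
  have h6 := Real.exp_le_exp.2 h4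
  have h7 : α * m + β ≤ (|α| + |β|) * m := by
    have := le_abs_self α
    have := le_abs_self β
    have := abs_nonneg β
    nlinarith
  have h8 : (|α| + |β|) * m * 16 ≤ m * a ^ 2 * m := by nlinarith
  have h9 : 0 < m * a ^ 2 * m := by positivity
  nlinarith

theorem inD_word {d : G → G → ℝ} (hd : InD d) :
    ∃ (S : Finset G) (l1 l2 e : ℝ), GenSymm (S : Set G) ∧ 0 < l1 ∧ 0 < l2 ∧ 0 ≤ e ∧
      (∀ x, (wordNorm (S : Set G) x : ℝ) / l1 - e ≤ d x 1) ∧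
      ∀ x, d x 1 ≤ l2 * (wordNorm (S : Set G) x : ℝ) + e := by
  obtain ⟨hp, hl, -, S, hS, l1, l2, e, h1, h2, he, hq⟩ := hd
  refine ⟨S, l1, l2, e, hS, h1, h2, he, fun x => ?_, fun x => ?_⟩
  · have := (hq 1 x).1
    unfold wordDist at this
    rwa [inv_one, one_mul, hp.2.1] at this
  · have := (hq 1 x).2
    unfold wordDist at this
    rwa [inv_one, one_mul, hp.2.1] at this

theorem ball_finite {d : G → G → ℝ} (hd : InD d) (t : ℝ) : {x : G | d x 1 ≤ t}.Finite := by
  classical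
  obtain ⟨S, l1, l2, e, hS, h1, h2, he, hW1, hW2⟩ := inD_word hd
  exact Set.Finite.subset (Finset.finite_toSet _) fun x hx => dball_sub hS h1 hW1 t x hx

open Classical Pointwise in
theorem key_lemma {d : G → G → ℝ} (hd : InD d) (hc : hCrit d = 1) :
    ∃ C : ℝ, ∀ z : G, ∃ p f : G, d p 1 ≤ C ∧ d f 1 ≤ C ∧ d z 1 ≤ tlen d (p * z * f) + C := by
  obtain ⟨S, l1, l2, e, hS, h1, h2, he, hW1, hW2⟩ := inD_word hd
  obtain ⟨hp, hl, ⟨δ, hδ, hh⟩, -⟩ := hd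
  obtain ⟨η, hη, hgrow⟩ := growth_lower hc hS h1 he hW1
  have hall := exists_wn_eq hS hη hgrow
  set T : Finset G := insert 1 S with hT
  have h1T : (1 : G) ∈ T := Finset.mem_insert_self _ _
  set σ := Real.log (T.card : ℝ) + 1 with hσ
  have hσ0 : 0 < σ := by
    have := Real.log_natCast_nonneg T.card
    linarith
  have hup : ∀ n : ℕ, ((T ^ n).card : ℝ) ≤ Real.exp (σ * n) := by
    intro n
    have e1 : ((T ^ n).card : ℝ) ≤ (T.card : ℝ) ^ n := by exact_mod_cast Finset.card_pow_le
    have e2 : (T.card : ℝ) ≤ Real.exp σ := by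
      have h0 : (0 : ℝ) < T.card := by exact_mod_cast Finset.card_pos.2 ⟨1, h1T⟩
      rw [← Real.log_le_iff_le_exp h0]
      linarith
    calc _ ≤ _ := e1
      _ ≤ (Real.exp σ) ^ n := by gcongr
      _ = _ := by rw [← Real.exp_nat_mul]; ring_nf
  set κ := min (1 / (4 * l1)) (η / (16 * l1 ^ 2 * l2 * σ)) with hκ
  have hκ0 : 0 < κ := lt_min (by positivity) (by positivity)
  have hκ1 : κ ≤ 1 / (4 * l1) := min_le_left _ _
  have hκ2 : κ ≤ η / (16 * l1 ^ 2 * l2 * σ) := min_le_right _ _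
  set a := η / (8 * l1 * l2) with ha
  have ha0 : 0 < a := by positivity
  have hκ3 : σ * l1 * (2 * κ) ≤ a := by
    calc σ * l1 * (2 * κ) ≤ σ * l1 * (2 * (η / (16 * l1 ^ 2 * l2 * σ))) := by gcongr
      _ = a := by rw [ha]; field_simp; norm_num
  obtain ⟨m1, hm1⟩ := eventually_atTop.1 (exp_beats ha0 (l2 + 1 / (4 * l1)) (e + 1)
    (σ * l1 * (8 * δ + 1 + e) + η * e / l2 + η))
  obtain ⟨m2, hm2⟩ := exists_nat_gt (4 * l1 * (e + 2 * δ))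
  obtain ⟨m, hm, g, h, hg, hhm, hgh⟩ := doubling hp hS hall he hW2 hκ0 (m1 + m2 + 1) (by omega)
  have hbeat := hm1 m (by omega)
  have hmm : 4 * l1 * (e + 2 * δ) < m := by
    have : (m2 : ℝ) ≤ m := by exact_mod_cast (by omega : m2 ≤ m)
    linarith
  set r := (m : ℝ) / (4 * l1) with hr
  have hre : e + 2 * δ < r := by rw [hr, lt_div_iff₀ (by positivity)]; linarith
  have hml : (m : ℝ) / l1 = 4 * r := by rw [hr]; field_simp
  have hκm : κ * m ≤ r := by
    calc κ * m ≤ 1 / (4 * l1) * m := by gcongr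
      _ = r := by rw [hr]; ring
  have hκm0 : 0 ≤ κ * m := by positivity
  have hr0 : 0 ≤ r := by linarith
  set c := κ * m + δ with hcdef
  have hc0 : 0 ≤ c := by positivity
  set B := T ^ ⌊(r - e) / l2⌋₊ with hB
  set E := T ^ ⌊l1 * ((2 * c + 6 * δ + 1) + e)⌋₊ with hE
  have hBr : ∀ f ∈ B, d f 1 ≤ r := by
    intro f hf
    rw [hB, mem_pow_iff hS] at hf
    have i1 : (wordNorm (S : Set G) f : ℝ) ≤ (r - e) / l2 :=
      le_trans (by exact_mod_cast hf) (Nat.floor_le (div_nonneg (by linarith) h2.le))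
    rw [le_div_iff₀ h2] at i1
    linarith [hW2 f]
  have h1B : (1 : G) ∈ B := by
    simpa using Finset.pow_mem_pow h1T (n := ⌊(r - e) / l2⌋₊)
  have hEE : ∀ f, d f 1 ≤ 2 * c + 6 * δ + 1 → f ∈ E := fun f hf => dball_sub hS h1 hW1 _ f hf
  have hEcard : (E.card : ℝ) ≤ Real.exp (a * m + σ * l1 * (8 * δ + 1 + e)) := by
    refine (hup _).trans (Real.exp_le_exp.2 ?_)
    have i1 : (⌊l1 * ((2 * c + 6 * δ + 1) + e)⌋₊ : ℝ) ≤ l1 * ((2 * c + 6 * δ + 1) + e) :=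
      Nat.floor_le (by positivity)
    calc _ ≤ σ * (l1 * ((2 * c + 6 * δ + 1) + e)) := by gcongr
      _ = σ * l1 * (2 * κ) * m + σ * l1 * (8 * δ + 1 + e) := by rw [hcdef]; ring
      _ ≤ _ := by gcongr
  have hBcard : Real.exp (2 * a * m - (η * e / l2 + η)) ≤ (B.card : ℝ) := by
    refine le_trans (Real.exp_le_exp.2 ?_) (hgrow _)
    have i1 := Nat.lt_floor_add_one ((r - e) / l2)
    calc 2 * a * m - (η * e / l2 + η) = η * ((r - e) / l2 - 1) := by
          rw [ha, hr]; field_simp; ring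
      _ ≤ _ := by gcongr; linarith
  have good : ∀ p : G, d p 1 ≤ l2 * m + e → 4 * r - e ≤ d p 1 → ∀ z : G,
      d p⁻¹ 1 + d z 1 - d p⁻¹ z ≤ 2 * c →
      ∃ f : G, d f 1 ≤ r ∧
        d z 1 ≤ tlen d (p * z * f) + (4 * d p 1 + 5 * r + 4 * δ) := by
    intro p hp1 hp2 z hz
    rw [d_inv hp hl] at hz
    have e1 : d (p * z) p = d z 1 := by simpa using hl p z 1
    have e2 : d (p * z) 1 = d p⁻¹ z := by
      have := hl p⁻¹ (p * z) 1
      rw [inv_mul_cancel_left, mul_one] at this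
      rw [← this, hp.2.1]
    have hcard : (⌊d p 1 + r⌋₊ + 1) * E.card < B.card := by
      have i1 : (⌊d p 1 + r⌋₊ : ℝ) ≤ d p 1 + r :=
        Nat.floor_le (add_nonneg (pm_nonneg hp _ _) hr0)
      have i2 : (⌊d p 1 + r⌋₊ : ℝ) + 1 <
          Real.exp (a * m - (σ * l1 * (8 * δ + 1 + e) + η * e / l2 + η)) := by
        refine lt_of_le_of_lt ?_ hbeat
        have : (l2 + 1 / (4 * l1)) * m = l2 * m + r := by rw [hr]; ring
        rw [this]; linarith
      have i3 : ((⌊d p 1 + r⌋₊ : ℝ) + 1) * E.card < B.card := by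
        refine lt_of_lt_of_le ?_ hBcard
        have i4 : Real.exp (2 * a * m - (η * e / l2 + η)) =
            Real.exp (a * m - (σ * l1 * (8 * δ + 1 + e) + η * e / l2 + η)) *
              Real.exp (a * m + σ * l1 * (8 * δ + 1 + e)) := by
          rw [← Real.exp_add]; ring_nf
        rw [i4]
        exact mul_lt_mul i2 hEcard
          (by exact_mod_cast Finset.card_pos.2 ⟨1, hEE 1 (by rw [hp.1]; positivity)⟩)
          (Real.exp_pos _).le
      exact_mod_cast i3
    obtain ⟨f, hf, hf2⟩ := pigeon hp hl hδ hh p r c hr0 hc0 (by linarith) B E hBr h1B hEE hcard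
      (p * z) (p * z)⁻¹ (by rw [e1, e2]; linarith)
    have hfr := hBr f hf
    refine ⟨f, hfr, ?_⟩
    set x := p * z with hx
    have t1 := tlen_lower hp hl hδ hh (x * f)
    have t2 := d_one_mul hp hl x f
    rw [d_inv hp hl] at hf2
    have t3 : d (f * x) x⁻¹ = d (x * f * x) 1 := by
      rw [d_eq_inv_mul hl, inv_inv, mul_assoc x f x]
    have t4 : d (x * f * x) 1 ≤ d ((x * f) ^ 2) 1 + d f 1 := by
      have := d_one_mul hp hl ((x * f) ^ 2) f⁻¹
      rw [d_inv hp hl] at this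
      have e3 : (x * f) ^ 2 * f⁻¹ = x * f * x := by
        rw [pow_two, ← mul_assoc, mul_inv_cancel_right]
      rwa [e3] at this
    have t5 : d x 1 ≤ d f 1 + d (f * x) 1 := by
      have := d_one_mul hp hl f⁻¹ (f * x)
      rwa [inv_mul_cancel_left, d_inv hp hl] at this
    have t6 : d z 1 ≤ d p 1 + d x 1 := by
      have := d_one_mul hp hl p⁻¹ x
      rwa [hx, inv_mul_cancel_left, d_inv hp hl] at this
    rw [t3] at hf2
    linarith [pm_nonneg hp p 1]
  have hgl := hW1 g
  have hgu := hW2 g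
  have hhl := hW1 h
  have hhu := hW2 h
  rw [hg, hml] at hgl
  rw [hg] at hgu
  rw [hhm, hml] at hhl
  rw [hhm] at hhu
  refine ⟨4 * (l2 * m + e) + 5 * r + 4 * δ, fun z => ?_⟩
  have hlm : 0 ≤ l2 * m + e := by positivity
  have e1 : d g⁻¹ h = d (g * h) 1 := by
    rw [hp.2.1, d_eq_inv_mul hl, inv_inv]
  have e2 : d h⁻¹⁻¹ 1 = d h 1 := by rw [inv_inv]
  have h4 := four_pt hp hh g⁻¹ z h 1
  rw [e1, d_inv hp hl g] at h4
  rcases h4 with h4 | h4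
  · obtain ⟨f, hf1, hf2⟩ := good g hgu hgl z (by rw [d_inv hp hl g]; linarith)
    exact ⟨g, f, by linarith, by linarith, by linarith⟩
  · have e3 := d_inv hp hl h
    obtain ⟨f, hf1, hf2⟩ := good h⁻¹ (by linarith) (by linarith) z (by
      rw [e2, inv_inv, hp.2.1 h z]; linarith)
    exact ⟨h⁻¹, f, by linarith, by linarith, by linarith⟩

/-- If `d, d' ∈ D(G)` have critical exponent `1`, then `Dil(d,d') ≥ 1`. -/
theorem one_le_Dil_of_normalized (G : Type*) [Group G]
    (hG : IsHyperbolicGroup G) (hne : NonElementary G)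
    (d d' : G → G → ℝ) (hd : InD d) (hd' : InD d')
    (h1 : hCrit d = 1) (h2 : hCrit d' = 1) :
    1 ≤ Dil d d' := by
  by_contra hlt
  push Not at hlt
  have hp := hd.1
  have hl := hd.2.1
  have hp' := hd'.1
  have hl' := hd'.2.1
  obtain ⟨A, B, hA, hB, hAB⟩ := compare hd hd'
  obtain ⟨A', B', hA', hB', hAB'⟩ := compare hd' hd
  have hbdd : BddAbove {r : ℝ | ∃ x : G, ¬ IsOfFinOrder x ∧ r = tlen d x / tlen d' x} := by
    refine ⟨A, ?_⟩
    rintro r ⟨x, -, rfl⟩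
    exact div_le_of_le_mul₀ (tlen_nonneg hp' x) hA (tlen_compare hp hp' hl' hA hB hAB x)
  set c := max (Dil d d') (1 / 2) with hc
  have hc1 : c < 1 := max_lt hlt (by norm_num)
  have hc0 : 0 < c := lt_of_lt_of_le (by norm_num) (le_max_right _ _)
  have htl : ∀ w : G, tlen d w ≤ c * tlen d' w := by
    intro w
    have h0 := tlen_nonneg hp' w
    by_cases hw : IsOfFinOrder w
    · rw [tlen_fin hp w hw]; positivity
    · rcases h0.eq_or_lt with h0 | h0
      · have := tlen_compare hp hp' hl' hA hB hAB w
        rw [← h0] at this ⊢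
        simpa using this
      · have h3 : tlen d w / tlen d' w ≤ Dil d d' := le_csSup hbdd ⟨w, hw, rfl⟩
        have h4 := h3.trans (le_max_left _ (1 / 2))
        rwa [div_le_iff₀ h0] at h4
  obtain ⟨C, hC⟩ := key_lemma hd h1
  set C2 := 2 * (A' * C + B') + C with hC2
  have main : ∀ z : G, d z 1 ≤ c * d' z 1 + C2 := by
    intro z
    obtain ⟨p, f, h3, h4, h5⟩ := hC z
    have h6 := htl (p * z * f)
    have h7 := tlen_le_norm hp' (p * z * f)
    have h8 := d_one_mul hp' hl' (p * z) f
    have h9 := d_one_mul hp' hl' p z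
    have i1 := hAB' p
    have i2 := hAB' f
    have i3 : A' * d p 1 ≤ A' * C := by gcongr
    have i4 : A' * d f 1 ≤ A' * C := by gcongr
    have i5 : c * tlen d' (p * z * f) ≤ c * (d' z 1 + 2 * (A' * C + B')) := by
      gcongr; linarith
    have i6 : 0 ≤ A' * C + B' := by
      have := pm_nonneg hp p 1
      have : 0 ≤ C := by linarith
      positivity
    have i7 : c * (2 * (A' * C + B')) ≤ 1 * (2 * (A' * C + B')) := by
      gcongr
    rw [mul_add] at i5
    linarith
  have hC20 : 0 ≤ C2 := by
    have := main 1
    rw [hp.1, hp'.1] at this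
    linarith
  set a := (1 + 1 / c) / 2 with ha
  have hcinv : 1 < 1 / c := by rw [lt_div_iff₀ hc0]; linarith
  have ha1 : 1 < a := by rw [ha]; linarith
  have hac : a * c < 1 := by
    have : (1 / c) * c = 1 := by field_simp
    have e1 : a * c = (c + (1 / c) * c) / 2 := by rw [ha]; ring
    rw [e1, this]; linarith
  obtain ⟨N, hN⟩ := eventually_atTop.1 (hCrit_eventually h1 ha1)
  obtain ⟨K, hK⟩ := exists_nat_gt ((N + 1 : ℝ) / c)
  refine hCrit_not_eventually h2 (a := (a * c + 1) / 2) (by linarith) ?_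
  filter_upwards [eventually_div_le (A := a * c) (B := a * (C2 + 1)) (a := (a * c + 1) / 2)
    (by linarith), eventually_ge_atTop K] with n hn hnK
  refine le_trans ?_ hn.2
  have hn0 : (0 : ℝ) < n := by exact_mod_cast hn.1
  gcongr
  set j := ⌈c * n + C2⌉₊ with hj
  have j1 : c * n + C2 ≤ j := Nat.le_ceil _
  have j2 : (j : ℝ) < c * n + C2 + 1 := Nat.ceil_lt_add_one (by positivity)
  have j3 : (N : ℝ) + 1 ≤ j := by
    rw [div_lt_iff₀ hc0] at hK
    have : (K : ℝ) ≤ n := by exact_mod_cast hnK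
    nlinarith
  have j4 : N ≤ j := by
    have : (N : ℝ) ≤ j := by linarith
    exact_mod_cast this
  have j5 := hN j j4
  have j6 : (0 : ℝ) < j := by
    have : (0 : ℝ) ≤ N := Nat.cast_nonneg N
    linarith
  rw [div_le_iff₀ j6] at j5
  have k1 : {x : G | d' x 1 ≤ (n : ℝ)} ⊆ {x : G | d x 1 ≤ (j : ℝ)} := by
    intro x hx
    have hx' : d' x 1 ≤ (n : ℝ) := hx
    have := main x
    have : c * d' x 1 ≤ c * n := by gcongr
    show d x 1 ≤ j
    linarith
  have k2 := Set.ncard_le_ncard k1 (ball_finite hd j)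
  have k3 : Real.log (Set.ncard {x : G | d' x 1 ≤ (n : ℝ)}) ≤
      Real.log (Set.ncard {x : G | d x 1 ≤ (j : ℝ)}) := by
    rcases Nat.eq_zero_or_pos (Set.ncard {x : G | d' x 1 ≤ (n : ℝ)}) with h0 | h0
    · rw [h0]; simpa using Real.log_natCast_nonneg _
    · exact Real.log_le_log (by exact_mod_cast h0) (by exact_mod_cast k2)
  calc _ ≤ _ := k3
    _ ≤ a * j := j5
    _ ≤ a * (c * n + C2 + 1) := by gcongr
    _ = _ := by ring

end
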